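/- For the metric g = diag(1, κ₂Sκ₁(r)², κ₂Sκ₁(r)²Sκ₂(θ)²) in coordinates (r,θ,φ), the curvature tensor R^i_{jkl} = ∂_kΓ^i_{lj} − ∂_lΓ^i_{kj} + ∑_m(Γ^i_{km}Γ^m_{lj} − Γ^i_{lm}Γ^m_{kj}) built from its Christoffel symbols has nonzero components (up to the antisymmetry R^i_{jkl} = −R^i_{jlk}) given by R^r_{θrθ} = R^φ_{θφθ} = κ₁κ₂Sκ₁(r)², R^r_{φrφ} = R^θ_{φθφ} = κ₁κ₂Sκ₁(r)²Sκ₂(θ)², R^θ_{rθr} = R^φ_{rφr} = κ₁; the Ricci tensor R_{jl} = ∑_i R^i_{jil} satisfies R_{rr} = 2κ₁, R_{θθ} = 2κ₁κ₂Sκ₁(r)², R_{φφ} = 2κ₁κ₂Sκ₁(r)²Sκ₂(θ)² (i.e. Ricci = 2κ₁·g), and the scalar curvature ∑_{j,l} g^{jl}R_{jl} equals 6κ₁, at every point where Sκ₁(r), Cκ₁(r), Sκ₂(θ), Cκ₂(θ) are nonzero. -/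

import Mathlib

namespace Paper
noncomputable section

/-- The κ-dependent cosine Cκ(x) = ∑ (−κ)^l x^{2l}/(2l)!. -/
def Ck (κ x : ℝ) : ℝ := ∑' l : ℕ, (-κ) ^ l * x ^ (2 * l) / (Nat.factorial (2 * l) : ℝ)

/-- The κ-dependent sine Sκ(x) = ∑ (−κ)^l x^{2l+1}/(2l+1)!. -/
def Sk (κ x : ℝ) : ℝ := ∑' l : ℕ, (-κ) ^ l * x ^ (2 * l + 1) / (Nat.factorial (2 * l + 1) : ℝ)

/-- The configuration space ℝ³ with coordinates (r, θ, φ) = (y 0, y 1, y 2). -/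
abbrev Pt3 := Fin 3 → ℝ

/-- Partial derivative in the i-th coordinate direction. -/
def pd3 (f : Pt3 → ℝ) (i : Fin 3) (y : Pt3) : ℝ := fderiv ℝ f y (Pi.single i 1)

/-- The diagonal metric g = diag(1, κ₂Sκ₁(r)², κ₂Sκ₁(r)²Sκ₂(θ)²). -/
def gmet (κ₁ κ₂ : ℝ) (y : Pt3) : Matrix (Fin 3) (Fin 3) ℝ :=
  Matrix.diagonal ![1, κ₂ * Sk κ₁ (y 0) ^ 2, κ₂ * Sk κ₁ (y 0) ^ 2 * Sk κ₂ (y 1) ^ 2]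

/-- The Christoffel symbols Γ^k_{ij} = (1/2)∑_l g^{kl}(∂_i g_{lj} + ∂_j g_{li} − ∂_l g_{ij}). -/
def Γf (κ₁ κ₂ : ℝ) (k i j : Fin 3) (y : Pt3) : ℝ :=
  (1 / 2) * ∑ l : Fin 3, (gmet κ₁ κ₂ y)⁻¹ k l *
    (pd3 (fun z => gmet κ₁ κ₂ z l j) i y + pd3 (fun z => gmet κ₁ κ₂ z l i) j y
      - pd3 (fun z => gmet κ₁ κ₂ z i j) l y)

/-- The domain where Sκ₁(r), Cκ₁(r), Sκ₂(θ), Cκ₂(θ) are all nonzero. -/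
def D3 (κ₁ κ₂ : ℝ) : Set Pt3 :=
  {y | Sk κ₁ (y 0) ≠ 0 ∧ Ck κ₁ (y 0) ≠ 0 ∧ Sk κ₂ (y 1) ≠ 0 ∧ Ck κ₂ (y 1) ≠ 0}

/-- The curvature tensor R^i_{jkl} built from the Christoffel symbols. -/
def Riem (κ₁ κ₂ : ℝ) (i j k l : Fin 3) (y : Pt3) : ℝ :=
  pd3 (Γf κ₁ κ₂ i l j) k y - pd3 (Γf κ₁ κ₂ i k j) l y
    + ∑ m : Fin 3, (Γf κ₁ κ₂ i k m y * Γf κ₁ κ₂ m l j y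
        - Γf κ₁ κ₂ i l m y * Γf κ₁ κ₂ m k j y)

/-- The Ricci tensor R_{jl} = ∑_i R^i_{jil}. -/
def Ric (κ₁ κ₂ : ℝ) (j l : Fin 3) (y : Pt3) : ℝ := ∑ i : Fin 3, Riem κ₁ κ₂ i j i l y

lemma hasSum_Ck {κ : ℝ} {s : ℂ} (hs : s ^ 2 = -κ) (x : ℝ) :
    HasSum (fun l : ℕ => (((-κ) ^ l * x ^ (2 * l) / (Nat.factorial (2 * l) : ℝ) : ℝ) : ℂ))
      (Complex.cosh (s * x)) := by
  convert Complex.hasSum_cosh (s * x) using 2 with l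
  push_cast
  rw [mul_pow, pow_mul s, hs]

lemma hasSum_mul_Sk {κ : ℝ} {s : ℂ} (hs : s ^ 2 = -κ) (x : ℝ) :
    HasSum (fun l : ℕ =>
        s * (((-κ) ^ l * x ^ (2 * l + 1) / (Nat.factorial (2 * l + 1) : ℝ) : ℝ) : ℂ))
      (Complex.sinh (s * x)) := by
  convert Complex.hasSum_sinh (s * x) using 2 with l
  push_cast
  rw [mul_pow, pow_succ s, pow_mul s, hs]
  ring

lemma ofReal_Ck {κ : ℝ} {s : ℂ} (hs : s ^ 2 = -κ) (x : ℝ) :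
    (Ck κ x : ℂ) = Complex.cosh (s * x) := by
  rw [Ck, Complex.ofReal_tsum, (hasSum_Ck hs x).tsum_eq]

lemma mul_ofReal_Sk {κ : ℝ} {s : ℂ} (hs : s ^ 2 = -κ) (x : ℝ) :
    s * (Sk κ x : ℂ) = Complex.sinh (s * x) := by
  rw [Sk, Complex.ofReal_tsum, ← tsum_mul_left, (hasSum_mul_Sk hs x).tsum_eq]

lemma exists_complex_sq_eq (κ : ℝ) : ∃ s : ℂ, s ^ 2 = -κ :=
  IsAlgClosed.exists_pow_nat_eq _ two_pos

lemma Sk_zero_left (x : ℝ) : Sk 0 x = x := by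
  rw [Sk, tsum_eq_single 0 fun l hl => by simp [hl]]
  simp

lemma Ck_zero_left (x : ℝ) : Ck 0 x = 1 := by
  rw [Ck, tsum_eq_single 0 fun l hl => by simp [hl]]
  simp

lemma Ck_sq_add (κ x : ℝ) : Ck κ x ^ 2 + κ * Sk κ x ^ 2 = 1 := by
  obtain ⟨s, hs⟩ := exists_complex_sq_eq κ
  have h := Complex.cosh_sq_sub_sinh_sq (s * x)
  rw [← ofReal_Ck hs, ← mul_ofReal_Sk hs, mul_pow, hs] at h
  have h' : (Ck κ x : ℂ) ^ 2 + κ * (Sk κ x : ℂ) ^ 2 = 1 := by linear_combination h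
  exact_mod_cast h'

lemma hasDerivAt_Ck (κ x : ℝ) : HasDerivAt (Ck κ) (-κ * Sk κ x) x := by
  obtain ⟨s, hs⟩ := exists_complex_sq_eq κ
  have h : HasDerivAt (fun z : ℂ => Complex.cosh (s * z)) (Complex.sinh (s * x) * (s * 1)) x :=
    ((hasDerivAt_id (x : ℂ)).const_mul s).ccosh
  convert h.real_of_complex using 1
  · ext t
    rw [← ofReal_Ck hs, Complex.ofReal_re]
  · rw [← mul_ofReal_Sk hs]
    have : s * (Sk κ x : ℂ) * (s * 1) = ((-κ * Sk κ x : ℝ) : ℂ) := by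
      push_cast
      linear_combination (Sk κ x : ℂ) * hs
    rw [this, Complex.ofReal_re]

lemma hasDerivAt_Sk (κ x : ℝ) : HasDerivAt (Sk κ) (Ck κ x) x := by
  rcases eq_or_ne κ 0 with rfl | hκ
  · rw [Ck_zero_left, funext Sk_zero_left]
    exact hasDerivAt_id' x
  obtain ⟨s, hs⟩ := exists_complex_sq_eq κ
  have hs0 : s ≠ 0 := by
    rintro rfl
    simp [hκ, eq_comm] at hs
  have h : HasDerivAt (fun z : ℂ => Complex.sinh (s * z) / s)
      (Complex.cosh (s * x) * (s * 1) / s) x :=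
    ((hasDerivAt_id (x : ℂ)).const_mul s).csinh.div_const s
  convert h.real_of_complex using 1
  · ext t
    rw [← mul_ofReal_Sk hs, mul_div_cancel_left₀ _ hs0, Complex.ofReal_re]
  · rw [mul_one, mul_div_cancel_right₀ _ hs0, ← ofReal_Ck hs, Complex.ofReal_re]

lemma continuous_Sk (κ : ℝ) : Continuous (Sk κ) :=
  continuous_iff_continuousAt.2 fun x => (hasDerivAt_Sk κ x).continuousAt

/-- Partial derivatives of a function that separates as `a(r) b(θ)`. -/
lemma pd3_separated {a b : ℝ → ℝ} {a' b' : ℝ} {y : Pt3} (ha : HasDerivAt a a' (y 0))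
    (hb : HasDerivAt b b' (y 1)) (i : Fin 3) :
    pd3 (fun z => a (z 0) * b (z 1)) i y = ![a' * b (y 1), a (y 0) * b', 0] i := by
  have ha' := ha.comp_hasFDerivAt y (hasFDerivAt_apply (𝕜 := ℝ) (0 : Fin 3) y)
  have hb' := hb.comp_hasFDerivAt y (hasFDerivAt_apply (𝕜 := ℝ) (1 : Fin 3) y)
  have h : HasFDerivAt (fun z : Pt3 => a (z 0) * b (z 1)) _ y := ha'.mul hb'
  rw [pd3, h.fderiv]
  fin_cases i <;> simp [mul_comm]

lemma pd3_const (c : ℝ) (i : Fin 3) (y : Pt3) : pd3 (fun _ => c) i y = 0 := by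
  simp [pd3]

lemma pd3_congr {f g : Pt3 → ℝ} {y : Pt3} (h : f =ᶠ[nhds y] g) (i : Fin 3) :
    pd3 f i y = pd3 g i y := by
  rw [pd3, pd3, h.fderiv_eq]

lemma pd3_gmet (κ₁ κ₂ : ℝ) (i j k : Fin 3) (y : Pt3) :
    pd3 (fun z => gmet κ₁ κ₂ z i j) k y =
      if i = j then
        ![![0, 0, 0],
          ![2 * κ₂ * Sk κ₁ (y 0) * Ck κ₁ (y 0), 0, 0],
          ![2 * κ₂ * Sk κ₁ (y 0) * Ck κ₁ (y 0) * Sk κ₂ (y 1) ^ 2,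
            2 * κ₂ * Sk κ₁ (y 0) ^ 2 * Sk κ₂ (y 1) * Ck κ₂ (y 1), 0]] i k
      else 0 := by
  split_ifs with hij
  · subst hij
    have hr := ((hasDerivAt_Sk κ₁ (y 0)).fun_pow 2).const_mul κ₂
    have hθ := (hasDerivAt_Sk κ₂ (y 1)).fun_pow 2
    have h₁ := pd3_separated hr (hasDerivAt_const (y 1) (1 : ℝ)) k
    have h₂ := pd3_separated hr hθ k
    fin_cases i
    · refine (pd3_const 1 k y).trans ?_
      fin_cases k <;> rfl
    · simp only [mul_one] at h₁
      simp only [gmet, Matrix.diagonal_apply_eq]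
      refine h₁.trans ?_
      fin_cases k <;> simp
      ring
    · simp only [gmet, Matrix.diagonal_apply_eq]
      refine h₂.trans ?_
      fin_cases k <;> simp [-mul_eq_mul_right_iff] <;> ring
  · simp only [gmet, Matrix.diagonal_apply_ne _ hij]
    exact pd3_const 0 k y

lemma gmet_inv {κ₁ κ₂ : ℝ} (hκ₂ : κ₂ ≠ 0) {y : Pt3} (hr : Sk κ₁ (y 0) ≠ 0)
    (hθ : Sk κ₂ (y 1) ≠ 0) :
    (gmet κ₁ κ₂ y)⁻¹ = Matrix.diagonal
      ![1, (κ₂ * Sk κ₁ (y 0) ^ 2)⁻¹, (κ₂ * Sk κ₁ (y 0) ^ 2 * Sk κ₂ (y 1) ^ 2)⁻¹] := by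
  apply Matrix.inv_eq_right_inv
  rw [gmet, Matrix.diagonal_mul_diagonal, ← Matrix.diagonal_one]
  congr 1
  ext i
  fin_cases i
  · simp
  · exact mul_inv_cancel₀ (mul_ne_zero hκ₂ (pow_ne_zero 2 hr))
  · exact mul_inv_cancel₀ (mul_ne_zero (mul_ne_zero hκ₂ (pow_ne_zero 2 hr)) (pow_ne_zero 2 hθ))

/-- Closed form of the Christoffel symbols `Γ^k_{ij}` of `gmet`. -/
def christoffel (κ₁ κ₂ : ℝ) (k i j : Fin 3) (y : Pt3) : ℝ :=
  ![![![0, 0, 0],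
      ![0, -κ₂ * Sk κ₁ (y 0) * Ck κ₁ (y 0), 0],
      ![0, 0, -κ₂ * Sk κ₁ (y 0) * Ck κ₁ (y 0) * Sk κ₂ (y 1) ^ 2]],
    ![![0, Ck κ₁ (y 0) / Sk κ₁ (y 0), 0],
      ![Ck κ₁ (y 0) / Sk κ₁ (y 0), 0, 0],
      ![0, 0, -(Sk κ₂ (y 1) * Ck κ₂ (y 1))]],
    ![![0, 0, Ck κ₁ (y 0) / Sk κ₁ (y 0)],
      ![0, 0, Ck κ₂ (y 1) / Sk κ₂ (y 1)],
      ![Ck κ₁ (y 0) / Sk κ₁ (y 0), Ck κ₂ (y 1) / Sk κ₂ (y 1), 0]]] k i j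

lemma Γf_eq_christoffel {κ₁ κ₂ : ℝ} (hκ₂ : κ₂ ≠ 0) {y : Pt3} (hr : Sk κ₁ (y 0) ≠ 0)
    (hθ : Sk κ₂ (y 1) ≠ 0) (k i j : Fin 3) :
    Γf κ₁ κ₂ k i j y = christoffel κ₁ κ₂ k i j y := by
  simp only [Γf, pd3_gmet, gmet_inv hκ₂ hr hθ, Fin.sum_univ_three]
  fin_cases k <;> fin_cases i <;> fin_cases j <;> simp [christoffel] <;> field_simp

/-- Closed form of `∂_l Γ^k_{ij}` for `gmet`. -/
def christoffelDeriv (κ₁ κ₂ : ℝ) (k i j l : Fin 3) (y : Pt3) : ℝ :=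
  let S := Sk κ₁ (y 0)
  let C := Ck κ₁ (y 0)
  let s := Sk κ₂ (y 1)
  let c := Ck κ₂ (y 1)
  ![![![0, 0, 0],
      ![0, ![-κ₂ * (C ^ 2 - κ₁ * S ^ 2), 0, 0] l, 0],
      ![0, 0, ![-κ₂ * (C ^ 2 - κ₁ * S ^ 2) * s ^ 2, -κ₂ * S * C * (2 * s * c), 0] l]],
    ![![0, ![-1 / S ^ 2, 0, 0] l, 0],
      ![![-1 / S ^ 2, 0, 0] l, 0, 0],
      ![0, 0, ![0, -(c ^ 2 - κ₂ * s ^ 2), 0] l]],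
    ![![0, 0, ![-1 / S ^ 2, 0, 0] l],
      ![0, 0, ![0, -1 / s ^ 2, 0] l],
      ![![-1 / S ^ 2, 0, 0] l, ![0, -1 / s ^ 2, 0] l, 0]]] k i j

lemma hasDerivAt_Ck_div_Sk (κ : ℝ) {x : ℝ} (hx : Sk κ x ≠ 0) :
    HasDerivAt (fun t => Ck κ t / Sk κ t) (-1 / Sk κ x ^ 2) x := by
  refine ((hasDerivAt_Ck κ x).fun_div (hasDerivAt_Sk κ x) hx).congr_deriv ?_
  congr 1
  linear_combination -Ck_sq_add κ x

lemma hasDerivAt_Sk_mul_Ck (κ x : ℝ) :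
    HasDerivAt (fun t => Sk κ t * Ck κ t) (Ck κ x ^ 2 - κ * Sk κ x ^ 2) x := by
  refine ((hasDerivAt_Sk κ x).fun_mul (hasDerivAt_Ck κ x)).congr_deriv ?_
  ring

lemma pd3_christoffel {κ₁ κ₂ : ℝ} {y : Pt3} (hr : Sk κ₁ (y 0) ≠ 0)
    (hθ : Sk κ₂ (y 1) ≠ 0) (k i j l : Fin 3) :
    pd3 (christoffel κ₁ κ₂ k i j) l y = christoffelDeriv κ₁ κ₂ k i j l y := by
  have hSC := (hasDerivAt_Sk_mul_Ck κ₁ (y 0)).const_mul (-κ₂)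
  have h₀ := pd3_const 0 l y
  have h₁ := pd3_separated hSC (hasDerivAt_const (y 1) (1 : ℝ)) l
  have h₂ := pd3_separated hSC ((hasDerivAt_Sk κ₂ (y 1)).fun_pow 2) l
  have h₃ := pd3_separated (hasDerivAt_Ck_div_Sk κ₁ hr) (hasDerivAt_const (y 1) (1 : ℝ)) l
  have h₄ := pd3_separated (hasDerivAt_const (y 0) (1 : ℝ)) (hasDerivAt_Sk_mul_Ck κ₂ (y 1)).neg l
  have h₅ := pd3_separated (hasDerivAt_const (y 0) (1 : ℝ)) (hasDerivAt_Ck_div_Sk κ₂ hθ) l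
  simp only [mul_one, one_mul, mul_zero, zero_mul, ← mul_assoc, Pi.neg_apply] at h₁ h₂ h₃ h₄ h₅
  fin_cases k <;> fin_cases i <;> fin_cases j <;>
    first
    | exact h₀
    | exact h₁
    | exact h₃
    | exact h₄
    | exact h₅
    | (refine h₂.trans ?_
       fin_cases l <;> simp [christoffelDeriv]
       ring)

lemma pd3_Γf {κ₁ κ₂ : ℝ} (hκ₂ : κ₂ ≠ 0) {y : Pt3} (hr : Sk κ₁ (y 0) ≠ 0)
    (hθ : Sk κ₂ (y 1) ≠ 0) (k i j l : Fin 3) :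
    pd3 (Γf κ₁ κ₂ k i j) l y = christoffelDeriv κ₁ κ₂ k i j l y := by
  rw [← pd3_christoffel hr hθ]
  apply pd3_congr
  have hcont (κ : ℝ) (m : Fin 3) : Continuous fun z : Pt3 => Sk κ (z m) :=
    (continuous_Sk κ).comp (continuous_apply m)
  filter_upwards [(hcont κ₁ 0).continuousAt.eventually_ne hr,
    (hcont κ₂ 1).continuousAt.eventually_ne hθ] with z hzr hzθ
  exact Γf_eq_christoffel hκ₂ hzr hzθ k i j

/-- `gmet` has constant sectional curvature `κ₁`. -/
lemma Riem_eq {κ₁ κ₂ : ℝ} (hκ₂ : κ₂ ≠ 0) {y : Pt3} (hr : Sk κ₁ (y 0) ≠ 0)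
    (hθ : Sk κ₂ (y 1) ≠ 0) (i j k l : Fin 3) :
    Riem κ₁ κ₂ i j k l y =
      κ₁ * ((if i = k then gmet κ₁ κ₂ y j l else 0) - if i = l then gmet κ₁ κ₂ y j k else 0) := by
  have h₁ := Ck_sq_add κ₁ (y 0)
  have h₂ := Ck_sq_add κ₂ (y 1)
  simp only [Riem, pd3_Γf hκ₂ hr hθ, Γf_eq_christoffel hκ₂ hr hθ, Fin.sum_univ_three]
  fin_cases i <;> fin_cases j <;> fin_cases k <;> fin_cases l <;>
    simp [christoffel, christoffelDeriv, gmet] <;> grind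

lemma Ric_eq {κ₁ κ₂ : ℝ} (hκ₂ : κ₂ ≠ 0) {y : Pt3} (hr : Sk κ₁ (y 0) ≠ 0)
    (hθ : Sk κ₂ (y 1) ≠ 0) (j l : Fin 3) :
    Ric κ₁ κ₂ j l y = 2 * κ₁ * gmet κ₁ κ₂ y j l := by
  simp only [Ric, Riem_eq hκ₂ hr hθ, Fin.sum_univ_three]
  fin_cases j <;> fin_cases l <;> simp [gmet] <;> ring

/-- the nonzero components of the Riemann tensor (up to the
antisymmetry in the last two indices), the Ricci tensor (equal to 2κ₁·g) and
the scalar curvature (equal to 6κ₁) of g = diag(1, κ₂Sκ₁(r)², κ₂Sκ₁(r)²Sκ₂(θ)²),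
with coordinates (r,θ,φ) = (0,1,2). -/
theorem curvature_of_metric (κ₁ κ₂ : ℝ) (hκ₂ : κ₂ ≠ 0) :
    ∀ y ∈ D3 κ₁ κ₂,
      (Riem κ₁ κ₂ 0 1 0 1 y = κ₁ * κ₂ * Sk κ₁ (y 0) ^ 2 ∧
       Riem κ₁ κ₂ 2 1 2 1 y = κ₁ * κ₂ * Sk κ₁ (y 0) ^ 2 ∧
       Riem κ₁ κ₂ 0 2 0 2 y = κ₁ * κ₂ * Sk κ₁ (y 0) ^ 2 * Sk κ₂ (y 1) ^ 2 ∧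
       Riem κ₁ κ₂ 1 2 1 2 y = κ₁ * κ₂ * Sk κ₁ (y 0) ^ 2 * Sk κ₂ (y 1) ^ 2 ∧
       Riem κ₁ κ₂ 1 0 1 0 y = κ₁ ∧
       Riem κ₁ κ₂ 2 0 2 0 y = κ₁) ∧
      (∀ i j k l : Fin 3, Riem κ₁ κ₂ i j k l y = -Riem κ₁ κ₂ i j l k y) ∧
      (∀ i j k l : Fin 3,
        (i, j, k, l) ∉ ({(0,1,0,1), (2,1,2,1), (0,2,0,2), (1,2,1,2), (1,0,1,0), (2,0,2,0),
                          (0,1,1,0), (2,1,1,2), (0,2,2,0), (1,2,2,1), (1,0,0,1), (2,0,0,2)} :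
            Set (Fin 3 × Fin 3 × Fin 3 × Fin 3)) →
          Riem κ₁ κ₂ i j k l y = 0) ∧
      (Ric κ₁ κ₂ 0 0 y = 2 * κ₁ ∧
       Ric κ₁ κ₂ 1 1 y = 2 * κ₁ * κ₂ * Sk κ₁ (y 0) ^ 2 ∧
       Ric κ₁ κ₂ 2 2 y = 2 * κ₁ * κ₂ * Sk κ₁ (y 0) ^ 2 * Sk κ₂ (y 1) ^ 2) ∧
      (∀ j l : Fin 3, Ric κ₁ κ₂ j l y = 2 * κ₁ * gmet κ₁ κ₂ y j l) ∧
      (∑ j : Fin 3, ∑ l : Fin 3, (gmet κ₁ κ₂ y)⁻¹ j l * Ric κ₁ κ₂ j l y = 6 * κ₁) := by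
  rintro y ⟨hr, -, hθ, -⟩
  have hR := Riem_eq hκ₂ hr hθ
  have hRic := Ric_eq hκ₂ hr hθ
  refine ⟨?_, ?_, ?_, ?_, hRic, ?_⟩
  · simp only [hR]
    refine ⟨?_, ?_, ?_, ?_, ?_, ?_⟩ <;> simp [gmet] <;> ring
  · intro i j k l
    rw [hR, hR]
    ring
  · intro i j k l h
    rw [hR]
    fin_cases i <;> fin_cases j <;> fin_cases k <;> fin_cases l <;>
      first
      | (simp [gmet]; done)
      | exact absurd h (by simp)
  · simp only [hRic]
    refine ⟨?_, ?_, ?_⟩ <;> simp [gmet] <;> ring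
  · have hinv := gmet_inv hκ₂ hr hθ
    simp only [hRic, hinv, Fin.sum_univ_three]
    simp [gmet]
    field_simp
    ring

end
end Paper
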